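/- Let A : ℝ^{n×n} → ℝ^{2m} be a linear map of the form A(X)_j = ⟨A_j, X⟩ for fixed matrices A_1, …, A_{2m}, and define B : ℝ^{n×n} → ℝ^m by B(X)_i := A(X)_{2i−1} − A(X)_{2i}. Let δ^{lb}_s, δ^{ub}_s denote the RIP-ℓ2/ℓ1 constants of B over rank-s matrices. Let Σ ∈ ℝ^{n×n} be positive semidefinite, write Σ = Σ_r + Σ_c where Σ_r is a best rank-r approximation of Σ, let η ∈ ℝ^{2m} satisfy ‖η‖_1 ≤ ε1, and set y := A(Σ) + η. Suppose Σ̂ minimizes trace(M) over all positive semidefinite M with ‖y − A(M)‖_1 ≤ ε1. If there exist a number K1 > 2r and β1 > 0 such that (1 − δ^{lb}_{2r+K1})/√2 − (1 + δ^{ub}_{K1})·√(2r/K1) ≥ β1, then ‖Σ̂ − Σ‖_F ≤ (1 + √(2r/K1))·(2/β1)·[ (1 + δ^{ub}_{K1})·‖Σ_c‖_*/√K1 + ε1/m ] + 2·‖Σ_c‖_*/√K1. -/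

import Mathlib

open Matrix

noncomputable section

/-- Frobenius norm of a real square matrix. -/
def frobNorm {n : ℕ} (X : Matrix (Fin n) (Fin n) ℝ) : ℝ :=
  Real.sqrt (∑ i, ∑ j, X i j ^ 2)

/-- Frobenius inner product `⟨Y, X⟩ = trace (Yᵀ X)`. -/
def finner {n : ℕ} (Y X : Matrix (Fin n) (Fin n) ℝ) : ℝ := ∑ i, ∑ j, Y i j * X i j

/-- Nuclear norm: the sum of the singular values of `X`. -/
def nuclearNorm {n : ℕ} (X : Matrix (Fin n) (Fin n) ℝ) : ℝ :=
  ∑ i, Real.sqrt ((Matrix.posSemidef_conjTranspose_mul_self X).1.eigenvalues i)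

/-- ℓ¹ norm of a vector. -/
def vecL1 {m : ℕ} (v : Fin m → ℝ) : ℝ := ∑ i, |v i|

/-- The linear map `X ↦ (⟨A_j, X⟩)_j`. -/
def measOf {n m : ℕ} (A : Fin m → Matrix (Fin n) (Fin n) ℝ)
    (X : Matrix (Fin n) (Fin n) ℝ) : Fin m → ℝ := fun j => finner (A j) X

/-- The debiased operator `B(X) i = A(X)_{2i-1} − A(X)_{2i}` (with `0`-based indexing). -/
def debiasedOf {n m : ℕ} (A : Fin (2 * m) → Matrix (Fin n) (Fin n) ℝ)
    (X : Matrix (Fin n) (Fin n) ℝ) : Fin m → ℝ := fun i =>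
  measOf A X ⟨2 * i.1, by have := i.2; omega⟩ - measOf A X ⟨2 * i.1 + 1, by have := i.2; omega⟩

/-- `Sr` is a best rank-`r` approximation of `S` in Frobenius norm. -/
def IsBestRankApprox {n : ℕ} (r : ℕ) (S Sr : Matrix (Fin n) (Fin n) ℝ) : Prop :=
  Sr.rank = r ∧ ∀ M : Matrix (Fin n) (Fin n) ℝ, M.rank = r →
    frobNorm (S - Sr) ≤ frobNorm (S - M)

lemma finner_eq_trace {n : ℕ} (Y X : Matrix (Fin n) (Fin n) ℝ) : finner Y X = (Yᵀ * X).trace := by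
  unfold finner
  rw [Finset.sum_comm]
  simp [Matrix.trace, Matrix.mul_apply]

lemma frob_sq {n : ℕ} (X : Matrix (Fin n) (Fin n) ℝ) : frobNorm X ^ 2 = (Xᵀ * X).trace := by
  rw [← finner_eq_trace, frobNorm, Real.sq_sqrt (by positivity)]
  simp [finner, sq]

lemma frob_nonneg {n : ℕ} (X : Matrix (Fin n) (Fin n) ℝ) : 0 ≤ frobNorm X := Real.sqrt_nonneg _

section
attribute [local instance] Matrix.frobeniusNormedAddCommGroup
lemma frob_eq_norm {n : ℕ} (X : Matrix (Fin n) (Fin n) ℝ) : frobNorm X = ‖X‖ := by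
  rw [Matrix.frobenius_norm_def, frobNorm, Real.sqrt_eq_rpow]
  simp

lemma frob_add_le {n : ℕ} (X Y : Matrix (Fin n) (Fin n) ℝ) :
    frobNorm (X + Y) ≤ frobNorm X + frobNorm Y := by
  simp only [frob_eq_norm]; exact norm_add_le _ _
end

lemma finner_le {n : ℕ} (Y X : Matrix (Fin n) (Fin n) ℝ) :
    finner Y X ≤ frobNorm Y * frobNorm X := by
  unfold finner frobNorm
  simp only [← Fintype.sum_prod_type']
  exact Real.sum_mul_le_sqrt_mul_sqrt _ (fun p : Fin n × Fin n => Y p.1 p.2) (fun p => X p.1 p.2)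

lemma spec {n : ℕ} {W : Matrix (Fin n) (Fin n) ℝ} (h : W.IsHermitian) :
    ∃ U : Matrix (Fin n) (Fin n) ℝ, Uᵀ * U = 1 ∧ U * Uᵀ = 1 ∧
      W = U * diagonal h.eigenvalues * Uᵀ := by
  refine ⟨h.eigenvectorUnitary, ?_, ?_, ?_⟩
  · have := Unitary.coe_star_mul_self h.eigenvectorUnitary
    simpa [star_eq_conjTranspose] using this
  · have := Unitary.coe_mul_star_self h.eigenvectorUnitary
    simpa [star_eq_conjTranspose] using this
  · conv_lhs => rw [h.spectral_theorem, Unitary.conjStarAlgAut_apply]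
    simp [star_eq_conjTranspose]

lemma rank_conj_diag {n : ℕ} (U V : Matrix (Fin n) (Fin n) ℝ) (d : Fin n → ℝ) (s : Finset (Fin n))
    (hd : ∀ i, i ∉ s → d i = 0) : (U * diagonal d * V).rank ≤ s.card := by
  classical
  refine (rank_mul_le_left _ _).trans ((rank_mul_le_right _ _).trans ?_)
  rw [rank_diagonal, Fintype.card_subtype]
  apply Finset.card_le_card
  intro i hi
  by_contra h
  simp at hi
  exact hi (hd i h)

lemma exists_proj {n : ℕ} (R : Matrix (Fin n) (Fin n) ℝ) :
    ∃ P Q : Matrix (Fin n) (Fin n) ℝ, P + Q = 1 ∧ Pᵀ = P ∧ Qᵀ = Q ∧ P * P = P ∧ Q * Q = Q ∧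
      P * Q = 0 ∧ Q * P = 0 ∧ Q * R = 0 ∧ P.rank ≤ R.rank ∧ P.trace = R.rank := by
  classical
  have h : (R * Rᵀ).IsHermitian := by
    simpa using isHermitian_mul_conjTranspose_self R
  obtain ⟨U, h1, h2, h3⟩ := spec h
  have hr := h.rank_eq_card_non_zero_eigs
  rw [rank_self_mul_transpose] at hr
  set μ := h.eigenvalues with hμ
  have key : ∀ a b : Fin n → ℝ, (U * diagonal a * Uᵀ) * (U * diagonal b * Uᵀ)
      = U * diagonal (fun i => a i * b i) * Uᵀ := by
    intro a b
    calc _ = U * diagonal a * (Uᵀ * U) * diagonal b * Uᵀ := by simp only [Matrix.mul_assoc]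
      _ = _ := by rw [h1, Matrix.mul_one, Matrix.mul_assoc U, diagonal_mul_diagonal]
  have kt : ∀ a : Fin n → ℝ, (U * diagonal a * Uᵀ)ᵀ = U * diagonal a * Uᵀ := by
    intro a; simp [Matrix.mul_assoc]
  have k0 : U * diagonal (fun _ => (0:ℝ)) * Uᵀ = 0 := by simp
  refine ⟨U * diagonal (fun i => if μ i ≠ 0 then 1 else 0) * Uᵀ,
    U * diagonal (fun i => if μ i ≠ 0 then 0 else 1) * Uᵀ, ?_, kt _, kt _, ?_, ?_, ?_, ?_, ?_, ?_, ?_⟩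
  · rw [← Matrix.add_mul, ← Matrix.mul_add, diagonal_add]
    have : (fun i => (if μ i ≠ 0 then (1:ℝ) else 0) + (if μ i ≠ 0 then 0 else 1)) = fun _ => 1 := by
      ext i; split_ifs <;> simp
    rw [this, diagonal_one, Matrix.mul_one, h2]
  · rw [key]; congr 3; ext i; split_ifs <;> simp
  · rw [key]; congr 3; ext i; split_ifs <;> simp
  · rw [key, ← k0]; congr 3; ext i; split_ifs <;> simp
  · rw [key, ← k0]; congr 3; ext i; split_ifs <;> simp
  · rw [← mul_self_mul_conjTranspose_eq_zero]
    simp only [conjTranspose_eq_transpose_of_trivial]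
    rw [h3, key, ← k0]; congr 3; ext i; split_ifs <;> simp_all
  · rw [hr, Fintype.card_subtype]
    apply rank_conj_diag
    intro i hi
    simp at hi
    simp [hi]
  · rw [Matrix.mul_assoc, trace_mul_comm, Matrix.mul_assoc, h1, Matrix.mul_one, trace_diagonal, hr,
      Fintype.card_subtype, Finset.sum_boole]

lemma trace_proj_le_nuclear {n : ℕ} (X P Q : Matrix (Fin n) (Fin n) ℝ) (hPQ : P + Q = 1)
    (hP : Pᵀ = P) (hQ : Qᵀ = Q) (hPP : P * P = P) (hQQ : Q * Q = Q) :
    (Q * X).trace ≤ nuclearNorm X := by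
  unfold nuclearNorm
  obtain ⟨V, h1, h2, h3⟩ := spec (Matrix.posSemidef_conjTranspose_mul_self X).1
  set μ := (Matrix.posSemidef_conjTranspose_mul_self X).1.eigenvalues
  have e : (Q * X).trace = ((Q * V)ᵀ * (X * V)).trace := by
    rw [transpose_mul, hQ, Matrix.mul_assoc, trace_mul_comm Vᵀ, Matrix.mul_assoc, Matrix.mul_assoc, h2,
      Matrix.mul_one]
  have hA : ∀ i, ∑ k, (X * V) k i ^ 2 = μ i := by
    intro i
    have : (X * V)ᵀ * (X * V) = diagonal μ := by
      simp only [conjTranspose_eq_transpose_of_trivial] at h3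
      calc _ = Vᵀ * (Xᵀ * X) * V := by simp only [transpose_mul, Matrix.mul_assoc]
        _ = (Vᵀ * V) * diagonal μ * (Vᵀ * V) := by rw [h3]; simp only [Matrix.mul_assoc]
        _ = _ := by rw [h1]; simp
    have := congrFun (congrFun this i) i
    rw [Matrix.mul_apply] at this
    simpa only [transpose_apply, ← sq, diagonal_apply_eq] using this
  have hB : ∀ i, ∑ k, (Q * V) k i ^ 2 ≤ 1 := by
    intro i
    have : (Q * V)ᵀ * (Q * V) + (P * V)ᵀ * (P * V) = 1 := by
      calc _ = Vᵀ * (Qᵀ * Q) * V + Vᵀ * (Pᵀ * P) * V := by simp only [transpose_mul, Matrix.mul_assoc]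
        _ = _ := by rw [hP, hQ, hPP, hQQ, ← Matrix.add_mul, ← Matrix.mul_add, add_comm Q, hPQ]; simp [h1]
    have := congrFun (congrFun this i) i
    rw [Matrix.add_apply, Matrix.mul_apply, Matrix.mul_apply] at this
    simp only [transpose_apply, ← sq, one_apply_eq] at this
    have h0 : 0 ≤ ∑ k, (P * V) k i ^ 2 := by positivity
    linarith
  rw [e, Matrix.trace]
  refine Finset.sum_le_sum fun i _ => ?_
  rw [diag_apply, Matrix.mul_apply]
  refine (Real.sum_mul_le_sqrt_mul_sqrt _ _ _).trans ?_
  simp only [transpose_apply]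
  rw [hA]
  have := Real.sqrt_le_one.2 (hB i)
  exact mul_le_of_le_one_left (Real.sqrt_nonneg _) this

lemma exists_top {ι : Type*} [DecidableEq ι] (f : ι → ℝ) (s : Finset ι) (K : ℕ) (hK : K ≤ s.card) :
    ∃ t ⊆ s, t.card = K ∧ ∀ i ∈ t, ∀ j ∈ s \ t, f j ≤ f i := by
  induction K with
  | zero => exact ⟨∅, by simp, by simp, by simp⟩
  | succ K ih =>
    obtain ⟨t, hts, hc, ht⟩ := ih (by omega)
    have hne : (s \ t).Nonempty := by
      rw [← Finset.card_pos, Finset.card_sdiff_of_subset hts]; omega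
    obtain ⟨a, ha, hmax⟩ := Finset.exists_max_image (s \ t) f hne
    have ha' := Finset.mem_sdiff.1 ha
    refine ⟨insert a t, Finset.insert_subset ha'.1 hts, by rw [Finset.card_insert_of_notMem ha'.2, hc], ?_⟩
    intro i hi j hj
    simp only [Finset.mem_sdiff, Finset.mem_insert, not_or] at hj hi
    have hj' : j ∈ s \ t := Finset.mem_sdiff.2 ⟨hj.1, hj.2.2⟩
    rcases hi with rfl | hi
    · exact hmax j hj'
    · exact ht i hi j hj'

lemma exists_thresh {ι : Type*} [DecidableEq ι] (f : ι → ℝ) (hf : ∀ i, 0 ≤ f i) (s : Finset ι)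
    (K : ℕ) (hK : 0 < K) (hs : K ≤ s.card) :
    ∃ t ⊆ s, t.card = K ∧ ∃ c, 0 ≤ c ∧ Real.sqrt K * c ≤ (∑ i ∈ t, f i) / Real.sqrt K ∧
      ∀ j ∈ s \ t, f j ≤ c := by
  obtain ⟨t, hts, hc, ht⟩ := exists_top f s K hs
  obtain ⟨a, ha, hmin⟩ := Finset.exists_min_image t f (by rw [← Finset.card_pos]; omega)
  have hK' : (0:ℝ) < Real.sqrt K := Real.sqrt_pos.2 (by exact_mod_cast hK)
  refine ⟨t, hts, hc, f a, hf a, ?_, ht a ha⟩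
  rw [le_div_iff₀ hK']
  have := Finset.card_nsmul_le_sum t f (f a) hmin
  rw [hc, nsmul_eq_mul] at this
  have h2 : Real.sqrt K * Real.sqrt K = (K:ℝ) := Real.mul_self_sqrt (by positivity)
  have h3 : Real.sqrt K * f a * Real.sqrt K = K * f a := by
    linear_combination f a * h2
  rw [h3]; exact this

lemma block {ι : Type*} [DecidableEq ι] (f : ι → ℝ) (hf : ∀ i, 0 ≤ f i) (K : ℕ) (hK : 0 < K)
    (C : ℝ) (hC : 0 ≤ C) (F : Finset ι → ℝ)
    (hsub : ∀ t s, t ⊆ s → F s ≤ F t + F (s \ t))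
    (hF : ∀ s : Finset ι, s.card ≤ K → F s ≤ C * Real.sqrt (∑ i ∈ s, f i ^ 2)) :
    ∀ (k : ℕ) (s : Finset ι), s.card ≤ k → ∀ c, 0 ≤ c → (∀ i ∈ s, f i ≤ c) →
      F s ≤ C * (Real.sqrt K * c + (∑ i ∈ s, f i) / Real.sqrt K) := by
  have base : ∀ s : Finset ι, s.card ≤ K → ∀ c, 0 ≤ c → (∀ i ∈ s, f i ≤ c) →
      F s ≤ C * (Real.sqrt K * c) := by
    intro s hs c hc h
    refine (hF s hs).trans (mul_le_mul_of_nonneg_left ?_ hC)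
    rw [Real.sqrt_le_iff]
    refine ⟨by positivity, ?_⟩
    rw [mul_pow, Real.sq_sqrt (by positivity)]
    calc ∑ i ∈ s, f i ^ 2 ≤ s.card • c ^ 2 :=
          Finset.sum_le_card_nsmul _ _ _ fun i hi => pow_le_pow_left₀ (hf i) (h i hi) 2
      _ ≤ K * c ^ 2 := by
          rw [nsmul_eq_mul]
          exact mul_le_mul_of_nonneg_right (by exact_mod_cast hs) (by positivity)
  intro k
  induction k with
  | zero =>
    intro s hs c hc h
    refine (base s (by omega) c hc h).trans (mul_le_mul_of_nonneg_left ?_ hC)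
    have : 0 ≤ (∑ i ∈ s, f i) / Real.sqrt K := div_nonneg (Finset.sum_nonneg fun i _ => hf i) (Real.sqrt_nonneg _)
    linarith
  | succ k ih =>
    intro s hs c hc h
    by_cases hsK : s.card ≤ K
    · refine (base s hsK c hc h).trans (mul_le_mul_of_nonneg_left ?_ hC)
      have : 0 ≤ (∑ i ∈ s, f i) / Real.sqrt K := div_nonneg (Finset.sum_nonneg fun i _ => hf i) (Real.sqrt_nonneg _)
      linarith
    · obtain ⟨t, hts, htc, c', hc', hle, hj⟩ := exists_thresh f hf s K hK (by omega)
      have h1 := base t (by omega) c hc (fun i hi => h i (hts hi))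
      have h2 := ih (s \ t) (by rw [Finset.card_sdiff_of_subset hts]; omega) c' hc' hj
      have h3 := hsub t s hts
      have h4 := Finset.sum_sdiff (f := f) hts
      have h5 := mul_le_mul_of_nonneg_left hle hC
      rw [← h4, add_div]
      nlinarith

lemma sum_pairs (g : ℕ → ℝ) (m : ℕ) :
    ∑ i ∈ Finset.range (2 * m), g i = ∑ i ∈ Finset.range m, (g (2 * i) + g (2 * i + 1)) := by
  induction m with
  | zero => simp
  | succ m ih => rw [Nat.mul_succ, Finset.sum_range_succ, Finset.sum_range_succ, ih, Finset.sum_range_succ]; ring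

lemma vecL1_debiased {n m : ℕ} (A : Fin (2 * m) → Matrix (Fin n) (Fin n) ℝ)
    (X : Matrix (Fin n) (Fin n) ℝ) : vecL1 (debiasedOf A X) ≤ vecL1 (measOf A X) := by
  unfold vecL1
  have e : ∑ i, |measOf A X i| =
      ∑ i ∈ Finset.range (2 * m), (if h : i < 2 * m then |measOf A X ⟨i, h⟩| else 0) := by
    rw [Finset.sum_range]; simp
  rw [e, sum_pairs, Finset.sum_range]
  refine Finset.sum_le_sum fun i _ => ?_
  have := i.2
  rw [dif_pos (by omega), dif_pos (by omega)]
  exact abs_sub _ _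

lemma measOf_add {n m : ℕ} (A : Fin m → Matrix (Fin n) (Fin n) ℝ) (X Y : Matrix (Fin n) (Fin n) ℝ) (j : Fin m) :
    measOf A (X + Y) j = measOf A X j + measOf A Y j := by
  simp [measOf, finner, mul_add, Finset.sum_add_distrib]

lemma measOf_sub {n m : ℕ} (A : Fin m → Matrix (Fin n) (Fin n) ℝ) (X Y : Matrix (Fin n) (Fin n) ℝ) (j : Fin m) :
    measOf A (X - Y) j = measOf A X j - measOf A Y j := by
  simp [measOf, finner, mul_sub, Finset.sum_sub_distrib]

lemma vecL1_deb_add {n m : ℕ} (A : Fin (2 * m) → Matrix (Fin n) (Fin n) ℝ)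
    (X Y : Matrix (Fin n) (Fin n) ℝ) :
    vecL1 (debiasedOf A (X + Y)) ≤ vecL1 (debiasedOf A X) + vecL1 (debiasedOf A Y) := by
  unfold vecL1
  rw [← Finset.sum_add_distrib]
  refine Finset.sum_le_sum fun i _ => ?_
  simp only [debiasedOf, measOf_add]
  refine le_trans (le_of_eq ?_) (abs_add_le _ _)
  congr 1; ring

lemma vecL1_deb_sub {n m : ℕ} (A : Fin (2 * m) → Matrix (Fin n) (Fin n) ℝ)
    (X Y : Matrix (Fin n) (Fin n) ℝ) :
    vecL1 (debiasedOf A X) ≤ vecL1 (debiasedOf A (X + Y)) + vecL1 (debiasedOf A Y) := by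
  unfold vecL1
  rw [← Finset.sum_add_distrib]
  refine Finset.sum_le_sum fun i _ => ?_
  simp only [debiasedOf, measOf_add]
  refine le_trans (le_of_eq ?_) (abs_sub _ _)
  congr 1; ring

lemma exists_parts {n : ℕ} {W : Matrix (Fin n) (Fin n) ℝ} (h : W.IsHermitian) :
    ∃ (μ : Fin n → ℝ) (Ws : Finset (Fin n) → Matrix (Fin n) (Fin n) ℝ),
      (∀ s, (Ws s).rank ≤ s.card) ∧
      (∀ s, frobNorm (Ws s) = Real.sqrt (∑ i ∈ s, |μ i| ^ 2)) ∧
      (∀ t s, t ⊆ s → Ws s = Ws t + Ws (s \ t)) ∧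
      Ws Finset.univ = W ∧
      (∀ Q : Matrix (Fin n) (Fin n) ℝ, Q * W = W → ∀ s, Q * Ws s = Ws s) ∧
      (∀ s, (Ws s)ᵀ = Ws s) ∧
      (∀ M1 M2 : Matrix (Fin n) (Fin n) ℝ, M1.PosSemidef → M2.PosSemidef → W = M1 - M2 →
        ∑ i, |μ i| ≤ M1.trace + M2.trace) := by
  classical
  obtain ⟨U, h1, h2, h3⟩ := spec h
  set μ := h.eigenvalues
  have kt : ∀ a : Fin n → ℝ, (U * diagonal a * Uᵀ)ᵀ = U * diagonal a * Uᵀ := by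
    intro a; simp [Matrix.mul_assoc]
  refine ⟨μ, fun s => U * diagonal (fun i => if i ∈ s then μ i else 0) * Uᵀ, ?_, ?_, ?_, ?_, ?_, ?_, ?_⟩
  · intro s
    exact rank_conj_diag _ _ _ _ (fun i hi => by simp [hi])
  · intro s
    rw [← Real.sqrt_sq (frob_nonneg _), frob_sq]
    congr 1
    rw [kt]
    calc _ = (U * (diagonal (fun i => if i ∈ s then μ i else 0) * (Uᵀ * U) *
        diagonal (fun i => if i ∈ s then μ i else 0) * Uᵀ)).trace := by simp only [Matrix.mul_assoc]
      _ = _ := by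
        rw [h1, Matrix.mul_one, trace_mul_comm, Matrix.mul_assoc, h1, Matrix.mul_one,
          diagonal_mul_diagonal, trace_diagonal]
        simp [sq, Finset.sum_ite_mem]
  · intro t s hts
    simp only []
    rw [← Matrix.add_mul, ← Matrix.mul_add, diagonal_add]
    congr 3
    ext i
    by_cases hi : i ∈ t
    · simp [hi, hts hi]
    · simp [hi]
  · simp only [Finset.mem_univ, if_true]
    exact h3.symm
  · intro Q hQ s
    have e : Q * U * diagonal μ = U * diagonal μ := by
      calc _ = Q * (U * diagonal μ * Uᵀ) * U := by
            simp only [Matrix.mul_assoc]; rw [h1, Matrix.mul_one]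
        _ = (U * diagonal μ * Uᵀ) * U := by rw [← h3, hQ]
        _ = _ := by rw [Matrix.mul_assoc, h1, Matrix.mul_one]
    have e2 : diagonal (fun i => if i ∈ s then μ i else 0)
        = diagonal μ * diagonal (fun i => if i ∈ s then (1:ℝ) else 0) := by
      rw [diagonal_mul_diagonal]; congr 1; ext i; simp
    simp only []
    rw [e2, ← Matrix.mul_assoc U, ← Matrix.mul_assoc, ← Matrix.mul_assoc, ← Matrix.mul_assoc, e]
  · intro s; exact kt _
  · intro M1 M2 p1 p2 hW
    have q1 := p1.conjTranspose_mul_mul_same U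
    have q2 := p2.conjTranspose_mul_mul_same U
    simp only [conjTranspose_eq_transpose_of_trivial] at q1 q2
    have t1 : ∀ M : Matrix (Fin n) (Fin n) ℝ, M.trace = (Uᵀ * M * U).trace := by
      intro M; rw [trace_mul_comm, ← Matrix.mul_assoc, h2, Matrix.one_mul]
    have e : diagonal μ = Uᵀ * M1 * U - Uᵀ * M2 * U := by
      rw [← Matrix.sub_mul, ← Matrix.mul_sub, ← hW, h3]
      calc _ = (Uᵀ * U) * diagonal μ * (Uᵀ * U) := by rw [h1]; simp
        _ = _ := by simp only [Matrix.mul_assoc]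
    rw [t1 M1, t1 M2, Matrix.trace, Matrix.trace, ← Finset.sum_add_distrib]
    refine Finset.sum_le_sum fun i _ => ?_
    have := congrFun (congrFun e i) i
    rw [diagonal_apply_eq, Matrix.sub_apply] at this
    have d1 := q1.diag_nonneg (i := i)
    have d2 := q2.diag_nonneg (i := i)
    rw [this, diag_apply, diag_apply, abs_le]
    constructor <;> linarith

lemma final_arith {a h T Nn C L β q k e sc H : ℝ} (hβ : 0 < β) (hC : 0 ≤ C) (hL : 0 ≤ L)
    (hq : 0 ≤ q) (hk : 0 < k)
    (hcond : β ≤ L / Real.sqrt 2 - C * q) (ha : 0 ≤ a) (hh : h ≤ a)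
    (hT : T ≤ q * k * h + 2 * sc) (hlow : L * a ≤ Nn + C * (T / k)) (hN : Nn ≤ 2 * e)
    (hH : H ≤ a + T / k) :
    H ≤ (1 + q) * (2 / β) * (C * sc / k + e) + 2 * sc / k := by
  have hT' : T / k ≤ q * a + 2 * sc / k := by
    rw [div_le_iff₀ hk, add_mul, div_mul_cancel₀ _ hk.ne']
    have := mul_le_mul_of_nonneg_left hh (mul_nonneg hq hk.le)
    linarith
  have hL' : L / Real.sqrt 2 ≤ L := by
    apply div_le_self hL
    rw [Real.one_le_sqrt]; norm_num
  have h1 : C * (T / k) ≤ C * (q * a + 2 * sc / k) := mul_le_mul_of_nonneg_left hT' hC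
  have h2 : β * a ≤ (L - C * q) * a := mul_le_mul_of_nonneg_right (by linarith) ha
  have h3 : a ≤ (2 / β) * (C * sc / k + e) := by
    rw [div_mul_eq_mul_div, le_div_iff₀ hβ]
    have : C * (2 * sc / k) = 2 * (C * sc / k) := by ring
    nlinarith
  have h4 := mul_le_mul_of_nonneg_left h3 (show 0 ≤ 1 + q by linarith)
  have : (1 + q) * (2 / β) * (C * sc / k + e) = (1 + q) * (2 / β * (C * sc / k + e)) := by ring
  rw [this]
  linarith

lemma rank_add_le' {n : ℕ} (X Y : Matrix (Fin n) (Fin n) ℝ) : (X + Y).rank ≤ X.rank + Y.rank := by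
  unfold Matrix.rank
  rw [Matrix.mulVecLin_add]
  refine (Submodule.finrank_mono (LinearMap.range_add_le _ _)).trans ?_
  exact Submodule.finrank_add_le_finrank_add_finrank _ _

lemma top_block {ι : Type*} [DecidableEq ι] [Fintype ι] (f : ι → ℝ) (hf : ∀ i, 0 ≤ f i) (K : ℕ)
    (hK : 0 < K) : ∃ T0 : Finset ι, T0.card ≤ K ∧ ∀ (C : ℝ), 0 ≤ C → ∀ (F : Finset ι → ℝ),
    (∀ t s, t ⊆ s → F s ≤ F t + F (s \ t)) →
    (∀ s : Finset ι, s.card ≤ K → F s ≤ C * Real.sqrt (∑ i ∈ s, f i ^ 2)) →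
    F (Finset.univ \ T0) ≤ C * ((∑ i, f i) / Real.sqrt K) := by
  by_cases h : K ≤ (Finset.univ : Finset ι).card
  · obtain ⟨t, hts, htc, c, hc, hle, hj⟩ := exists_thresh f hf Finset.univ K hK h
    refine ⟨t, htc.le, fun C hC F hsub hF => ?_⟩
    refine (block f hf K hK C hC F hsub hF _ _ le_rfl c hc hj).trans
      (mul_le_mul_of_nonneg_left ?_ hC)
    rw [← Finset.sum_sdiff hts, add_div]
    linarith
  · refine ⟨Finset.univ, by omega, fun C hC F hsub hF => ?_⟩
    rw [Finset.sdiff_self]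
    refine (hF ∅ (by simp)).trans (mul_le_mul_of_nonneg_left ?_ hC)
    rw [Finset.sum_empty, Real.sqrt_zero]
    exact div_nonneg (Finset.sum_nonneg fun i _ => hf i) (Real.sqrt_nonneg _)

/-- **Lemma 1 (deterministic recovery of low-rank matrices via RIP-ℓ₂/ℓ₁).** -/
theorem low_rank_duality_lemma {n m r K1 : ℕ}
    (A : Fin (2 * m) → Matrix (Fin n) (Fin n) ℝ)
    (δlb δub : ℕ → ℝ)
    (hRIP : ∀ (s : ℕ) (X : Matrix (Fin n) (Fin n) ℝ), X.rank ≤ s →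
      (1 - δlb s) * frobNorm X ≤ (1 / (m : ℝ)) * vecL1 (debiasedOf A X) ∧
      (1 / (m : ℝ)) * vecL1 (debiasedOf A X) ≤ (1 + δub s) * frobNorm X)
    (S Sr Shat : Matrix (Fin n) (Fin n) ℝ) (ε1 : ℝ) (η : Fin (2 * m) → ℝ)
    (hS : S.PosSemidef) (hSr : IsBestRankApprox r S Sr)
    (hη : vecL1 η ≤ ε1)
    (hfeas1 : Shat.PosSemidef)
    (hfeas2 : vecL1 (fun j => (measOf A S j + η j) - measOf A Shat j) ≤ ε1)
    (hmin : ∀ M : Matrix (Fin n) (Fin n) ℝ, M.PosSemidef →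
      vecL1 (fun j => (measOf A S j + η j) - measOf A M j) ≤ ε1 → Shat.trace ≤ M.trace)
    (β1 : ℝ) (hK1 : 2 * r < K1) (hβ1 : 0 < β1)
    (hcond : β1 ≤ (1 - δlb (2 * r + K1)) / Real.sqrt 2 -
      (1 + δub K1) * Real.sqrt (2 * (r : ℝ) / (K1 : ℝ))) :
    frobNorm (Shat - S) ≤
      (1 + Real.sqrt (2 * (r : ℝ) / (K1 : ℝ))) * (2 / β1) *
        ((1 + δub K1) * nuclearNorm (S - Sr) / Real.sqrt (K1 : ℝ) + ε1 / (m : ℝ)) +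
      2 * nuclearNorm (S - Sr) / Real.sqrt (K1 : ℝ) := by
  classical
  have hε : 0 ≤ ε1 := le_trans (Finset.sum_nonneg fun i _ => abs_nonneg _) hη
  rcases Nat.eq_zero_or_pos n with hn | hn
  · subst hn
    have e1 : ∀ X : Matrix (Fin 0) (Fin 0) ℝ, frobNorm X = 0 := by intro X; simp [frobNorm]
    have e2 : ∀ X : Matrix (Fin 0) (Fin 0) ℝ, nuclearNorm X = 0 := by intro X; simp [nuclearNorm]
    rw [e1, e2]
    simp only [mul_zero, zero_div, zero_add, add_zero]
    positivity
  have hK : 0 < K1 := by omega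
  have hKs : 0 < Real.sqrt (K1 : ℝ) := Real.sqrt_pos.2 (by exact_mod_cast hK)
  have hm : 0 ≤ 1 / (m : ℝ) := by positivity
  have hC : 0 ≤ 1 + δub K1 := by
    let E : Matrix (Fin n) (Fin n) ℝ := 1 * diagonal (fun i => if i = ⟨0, hn⟩ then 1 else 0) * 1
    have hr : E.rank ≤ K1 := by
      refine (rank_conj_diag 1 1 _ {⟨0, hn⟩} ?_).trans (by simp; omega)
      intro i hi
      simp at hi
      simp [hi]
    have hE : frobNorm E ^ 2 = 1 := by
      rw [frob_sq]
      simp [E]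
    have hE' : frobNorm E = 1 := by
      have := frob_nonneg E
      nlinarith
    have h := (hRIP K1 E hr).2
    rw [hE', mul_one] at h
    refine le_trans (mul_nonneg hm (Finset.sum_nonneg fun i _ => abs_nonneg _)) h
  have hL : 0 ≤ 1 - δlb (2 * r + K1) := by
    have h1 : 0 ≤ (1 - δlb (2 * r + K1)) / Real.sqrt 2 := by
      have := mul_nonneg hC (Real.sqrt_nonneg (2 * (r : ℝ) / (K1 : ℝ)))
      linarith
    have h2 : (0:ℝ) < Real.sqrt 2 := by positivity
    by_contra hneg
    push Not at hneg
    have := div_neg_of_neg_of_pos hneg h2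
    linarith
  obtain ⟨P, Q, hPQ, hPt, hQt, hPP, hQQ, hPQ0, hQP0, hQR, hPr, hPtr⟩ := exists_proj Sr
  rw [hSr.1] at hPr hPtr
  set H := Shat - S with hH
  have hHs : Hᵀ = H := by
    have a1 := hfeas1.1.eq
    have a2 := hS.1.eq
    simp only [conjTranspose_eq_transpose_of_trivial] at a1 a2
    rw [hH, transpose_sub, a1, a2]
  set W := Q * H * Q with hW
  have hWt : Wᵀ = W := by
    rw [hW, transpose_mul, transpose_mul, hQt, hHs, Matrix.mul_assoc]
  have hWh : W.IsHermitian := by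
    rw [Matrix.IsHermitian, conjTranspose_eq_transpose_of_trivial, hWt]
  have hQW : Q * W = W := by
    rw [hW, ← Matrix.mul_assoc, ← Matrix.mul_assoc, hQQ]
  set HT := H - W with hHT
  have hHTt : HTᵀ = HT := by rw [hHT, transpose_sub, hHs, hWt]
  have hQHTQ : Q * HT * Q = 0 := by
    rw [hHT, Matrix.mul_sub, Matrix.sub_mul, hQW]
    rw [hW, Matrix.mul_assoc (Q * H), hQQ, sub_self]
  have hHTeq : HT = P * H + Q * H * P := by
    have hP : P = 1 - Q := eq_sub_of_add_eq hPQ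
    rw [hHT, hW, hP]
    noncomm_ring
  have hHTr : HT.rank ≤ 2 * r := by
    rw [hHTeq]
    refine (rank_add_le' _ _).trans ?_
    have a1 := (rank_mul_le_left P H).trans hPr
    have a2 := (rank_mul_le_right (Q * H) P).trans hPr
    omega
  obtain ⟨μ, Ws, w1, w2, w3, w4, w5, w6, w7⟩ := exists_parts hWh
  obtain ⟨T0, hT0, hblk⟩ := top_block (fun i => |μ i|) (fun i => abs_nonneg _) K1 hK
  set H1 := Ws T0 with hH1
  set H2 := Ws (Finset.univ \ T0) with hH2
  have hW12 : W = H1 + H2 := by rw [← w4]; exact w3 _ _ (Finset.subset_univ _)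
  have hHsplit : H = (HT + H1) + H2 := by
    rw [add_assoc, ← hW12, hHT]; abel
  have hfr : frobNorm H2 ≤ 1 * ((∑ i, |μ i|) / Real.sqrt K1) := by
    refine hblk 1 zero_le_one (fun s => frobNorm (Ws s)) ?_ ?_
    · intro t s hts
      rw [w3 t s hts]; exact frob_add_le _ _
    · intro s _
      rw [one_mul, w2 s]
  have hNr : 1 / (m : ℝ) * vecL1 (debiasedOf A H2) ≤
      (1 + δub K1) * ((∑ i, |μ i|) / Real.sqrt K1) := by
    refine hblk _ hC (fun s => 1 / (m : ℝ) * vecL1 (debiasedOf A (Ws s))) ?_ ?_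
    · intro t s hts
      rw [w3 t s hts, ← mul_add]; exact mul_le_mul_of_nonneg_left (vecL1_deb_add _ _ _) hm
    · intro s hs
      rw [← w2 s]
      exact (hRIP K1 (Ws s) ((w1 s).trans hs)).2
  have hlow : (1 - δlb (2 * r + K1)) * frobNorm (HT + H1) ≤
      1 / (m : ℝ) * vecL1 (debiasedOf A H) + (1 + δub K1) * ((∑ i, |μ i|) / Real.sqrt K1) := by
    have a1 := (hRIP (2 * r + K1) (HT + H1) ((rank_add_le' _ _).trans
      (add_le_add hHTr ((w1 T0).trans hT0)))).1
    have a2 := mul_le_mul_of_nonneg_left (vecL1_deb_sub A (HT + H1) H2) hm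
    rw [← hHsplit, mul_add] at a2
    linarith
  have hN : 1 / (m : ℝ) * vecL1 (debiasedOf A H) ≤ 2 * (ε1 / m) := by
    have a1 : vecL1 (measOf A H) ≤ 2 * ε1 := by
      have : vecL1 (measOf A H) ≤ vecL1 η +
          vecL1 (fun j => (measOf A S j + η j) - measOf A Shat j) := by
        unfold vecL1
        rw [← Finset.sum_add_distrib]
        refine Finset.sum_le_sum fun i _ => ?_
        rw [hH, measOf_sub]
        refine le_trans (le_of_eq ?_) (abs_sub _ _)
        congr 1; ring
      linarith
    have a2 := mul_le_mul_of_nonneg_left ((vecL1_debiased A H).trans a1) hm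
    refine a2.trans (le_of_eq ?_)
    ring
  have hHle : frobNorm H ≤ frobNorm (HT + H1) + (∑ i, |μ i|) / Real.sqrt K1 := by
    have := frob_add_le (HT + H1) H2
    rw [← hHsplit] at this
    linarith
  have hpyth : frobNorm HT ≤ frobNorm (HT + H1) := by
    have b1 : Q * H1 = H1 := w5 Q hQW T0
    have b2 : H1ᵀ = H1 := w6 T0
    have b3 : H1 * Q = H1 := by
      have := congrArg transpose b1
      rwa [transpose_mul, hQt, b2] at this
    have c1 : (HT * H1).trace = 0 := by
      calc (HT * H1).trace = (HT * (Q * (H1 * Q))).trace := by rw [b3, b1]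
        _ = ((HT * Q * H1) * Q).trace := by simp only [Matrix.mul_assoc]
        _ = ((Q * HT * Q) * H1).trace := by rw [trace_mul_comm]; simp only [Matrix.mul_assoc]
        _ = 0 := by rw [hQHTQ]; simp
    have c2 : frobNorm (HT + H1) ^ 2 = frobNorm HT ^ 2 + frobNorm H1 ^ 2 := by
      rw [frob_sq, frob_sq, frob_sq, transpose_add, hHTt, b2, Matrix.add_mul, Matrix.mul_add,
        Matrix.mul_add, trace_add, trace_add, trace_add, c1, trace_mul_comm H1 HT, c1]
      ring
    refine (sq_le_sq₀ (frob_nonneg _) (frob_nonneg _)).1 ?_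
    have := sq_nonneg (frobNorm H1)
    linarith
  have hT : ∑ i, |μ i| ≤ Real.sqrt (2 * (r : ℝ) / (K1 : ℝ)) * Real.sqrt K1 * frobNorm HT
      + 2 * nuclearNorm (S - Sr) := by
    have p1 := hfeas1.conjTranspose_mul_mul_same Q
    have p2 := hS.conjTranspose_mul_mul_same Q
    rw [conjTranspose_eq_transpose_of_trivial, hQt] at p1 p2
    have d1 := w7 _ _ p1 p2 (by rw [hW, hH]; noncomm_ring)
    have d2 : ∀ M : Matrix (Fin n) (Fin n) ℝ, (Q * M * Q).trace = (Q * M).trace := by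
      intro M; rw [trace_mul_comm, ← Matrix.mul_assoc, hQQ]
    rw [d2, d2] at d1
    have d3 : (Q * S).trace ≤ nuclearNorm (S - Sr) := by
      have := trace_proj_le_nuclear (S - Sr) P Q hPQ hPt hQt hPP hQQ
      rwa [Matrix.mul_sub, hQR, sub_zero] at this
    have d4 : (Q * Shat).trace = (Q * H).trace + (Q * S).trace := by
      rw [← trace_add, ← Matrix.mul_add, hH, sub_add_cancel]
    have d5 : H.trace ≤ 0 := by
      have : Shat.trace ≤ S.trace := by
        apply hmin S hS
        simpa using hη
      rw [hH, trace_sub]; linarith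
    have d6 : H.trace = (P * H).trace + (Q * H).trace := by
      rw [← trace_add, ← Matrix.add_mul, hPQ, Matrix.one_mul]
    have d7 : (P * H).trace = (P * HT).trace := by
      rw [hHTeq, Matrix.mul_add, ← Matrix.mul_assoc P, ← Matrix.mul_assoc P, ← Matrix.mul_assoc P,
        hPQ0, hPP]
      simp
    have d8 : -(P * HT).trace ≤ Real.sqrt r * frobNorm HT := by
      have e1 := finner_le (-P) HT
      rw [finner_eq_trace, transpose_neg, hPt, Matrix.neg_mul, trace_neg] at e1
      have e2 : frobNorm (-P) = Real.sqrt r := by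
        rw [← Real.sqrt_sq (frob_nonneg _), frob_sq]
        simp [hPt, hPP, hPtr]
      rwa [e2] at e1
    have d9 : Real.sqrt r * frobNorm HT ≤
        Real.sqrt (2 * (r : ℝ) / (K1 : ℝ)) * Real.sqrt K1 * frobNorm HT := by
      refine mul_le_mul_of_nonneg_right ?_ (frob_nonneg _)
      rw [← Real.sqrt_mul (by positivity), div_mul_cancel₀ _ (by positivity)]
      apply Real.sqrt_le_sqrt
      have : (0:ℝ) ≤ r := by positivity
      linarith
    linarith
  exact final_arith hβ1 hC hL (Real.sqrt_nonneg _) hKs hcond (frob_nonneg _) hpyth hT hlow hN hHle
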